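/- Let T ≥ 0 and let ρ be a Borel probability measure on [0,∞) with ρ({0}) = 0. If F is a bounded Borel function on [0,T] with ‖F‖_∞ ≤ 1/2, then K[F] := Σ_{n≥1} K_n[0,F] (with (K_n[0,F])_{n≥0} the unique solution of the triangular system for B = 0 and this F, the series converging absolutely in supremum norm) is the unique bounded Borel solution on [0,T] of the convolutional Riccati equation K = F + ½(K²)*ρ. -/

import Mathlib

open MeasureTheory

/-- The convolution of a function with a measure:
`(g * ρ)(t) = ∫_{[0,t]} g(t-s) ρ(ds)`. -/
noncomputable def mconv (g : ℝ → ℝ) (ρ : Measure ℝ) (t : ℝ) : ℝ :=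
  ∫ s in Set.Icc 0 t, g (t - s) ∂ρ

/-- The supremum norm of a function over `[0,T]`. -/
noncomputable def supNorm (g : ℝ → ℝ) (T : ℝ) : ℝ :=
  sSup ((fun t => |g t|) '' Set.Icc 0 T)

/-- `K : ℕ → ℝ → ℝ` is a bounded Borel solution on `[0,T]` of the infinite
triangular system `K₀ = B`, `K₁ = F + (K₀K₁)*ρ`,
`K_n = (½ Σ_{i=0}^{n} K_i K_{n-i})*ρ` for `n ≥ 2`. -/
def SolvesSystem (T : ℝ) (ρ : Measure ℝ) (B F : ℝ → ℝ) (K : ℕ → ℝ → ℝ) : Prop :=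
  (∀ n, Measurable (K n)) ∧
  (∀ n, ∃ M : ℝ, ∀ t ∈ Set.Icc 0 T, |K n t| ≤ M) ∧
  (∀ t ∈ Set.Icc 0 T, K 0 t = B t) ∧
  (∀ t ∈ Set.Icc 0 T, K 1 t = F t + mconv (fun u => K 0 u * K 1 u) ρ t) ∧
  (∀ n, 2 ≤ n → ∀ t ∈ Set.Icc 0 T,
    K n t = mconv (fun u => 2⁻¹ * ∑ i ∈ Finset.range (n + 1), K i u * K (n - i) u) ρ t)

lemma abs_le_supNorm {g : ℝ → ℝ} {T : ℝ} (hg : ∃ M : ℝ, ∀ t ∈ Set.Icc 0 T, |g t| ≤ M)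
    {t : ℝ} (ht : t ∈ Set.Icc 0 T) : |g t| ≤ supNorm g T := by
  obtain ⟨M, hM⟩ := hg
  refine le_csSup ⟨M, ?_⟩ ⟨t, ht, rfl⟩
  rintro _ ⟨u, hu, rfl⟩
  exact hM u hu

lemma supNorm_le {g : ℝ → ℝ} {T M : ℝ} (hT : 0 ≤ T) (hM : ∀ t ∈ Set.Icc 0 T, |g t| ≤ M) :
    supNorm g T ≤ M := by
  refine csSup_le ⟨_, 0, ⟨le_rfl, hT⟩, rfl⟩ ?_
  rintro _ ⟨u, hu, rfl⟩
  exact hM u hu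

lemma supNorm_nonneg (g : ℝ → ℝ) (T : ℝ) : 0 ≤ supNorm g T := by
  refine Real.sSup_nonneg ?_
  rintro _ ⟨u, -, rfl⟩
  exact abs_nonneg _

lemma sub_mem_Icc_of_mem_Icc {T t s : ℝ} (ht : t ∈ Set.Icc 0 T) (hs : s ∈ Set.Icc 0 t) :
    t - s ∈ Set.Icc 0 T :=
  ⟨by linarith [hs.2], by linarith [hs.1, ht.2]⟩

lemma mconv_congr {f g : ℝ → ℝ} {ρ : Measure ℝ} {T t : ℝ} (ht : t ∈ Set.Icc 0 T)
    (h : ∀ u ∈ Set.Icc 0 T, f u = g u) : mconv f ρ t = mconv g ρ t :=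
  setIntegral_congr_fun measurableSet_Icc fun _ hs => h _ (sub_mem_Icc_of_mem_Icc ht hs)

lemma integrableOn_comp_sub {g : ℝ → ℝ} {ρ : Measure ℝ} [IsFiniteMeasure ρ] {T M t : ℝ}
    (hg : Measurable g) (hM : ∀ u ∈ Set.Icc 0 T, |g u| ≤ M) (ht : t ∈ Set.Icc 0 T) :
    IntegrableOn (fun s => g (t - s)) (Set.Icc 0 t) ρ := by
  refine Integrable.of_bound (hg.comp (measurable_const.sub measurable_id)).aestronglyMeasurable M ?_
  filter_upwards [ae_restrict_mem measurableSet_Icc] with s hs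
  exact hM _ (sub_mem_Icc_of_mem_Icc ht hs)

lemma abs_mconv_le {g : ℝ → ℝ} {ρ : Measure ℝ} [IsProbabilityMeasure ρ] {T M t : ℝ}
    (hM : ∀ u ∈ Set.Icc 0 T, |g u| ≤ M) (ht : t ∈ Set.Icc 0 T) : |mconv g ρ t| ≤ M := by
  have h := norm_setIntegral_le_of_norm_le_const (f := fun s => g (t - s)) (C := M)
    (measure_lt_top ρ (Set.Icc 0 t)) fun s hs => hM _ (sub_mem_Icc_of_mem_Icc ht hs)
  have hM0 : 0 ≤ M := (abs_nonneg _).trans (hM t ht)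
  exact h.trans (mul_le_of_le_one_right hM0 measureReal_le_one)

/-- The integral of a countable sum, under a summable uniform bound. -/
lemma hasSum_mconv {g : ℕ → ℝ → ℝ} {ρ : Measure ℝ} [IsProbabilityMeasure ρ] {T t : ℝ}
    {M : ℕ → ℝ} (hg : ∀ n, Measurable (g n)) (hM : ∀ n, ∀ u ∈ Set.Icc 0 T, |g n u| ≤ M n)
    (hs : Summable M) (ht : t ∈ Set.Icc 0 T) :
    HasSum (fun n => mconv (g n) ρ t) (mconv (fun u => ∑' n, g n u) ρ t) := by
  refine hasSum_integral_of_summable_integral_norm (F := fun n s => g n (t - s))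
    (fun n => integrableOn_comp_sub (hg n) (hM n) ht) ?_
  refine Summable.of_nonneg_of_le (fun n => integral_nonneg fun s => norm_nonneg _)
    (fun n => ?_) hs
  refine (le_abs_self _).trans (abs_mconv_le (g := fun u => |g n u|) (T := T) ?_ ht)
  intro u hu
  rw [abs_abs]
  exact hM n u hu

/-- A nonnegative sequence dominated by the Catalan-type recursion with initial value `1/2` has
partial sums at most `1`. -/
lemma sum_range_le_one_of_le_convolution {k : ℕ → ℝ} (hk : ∀ n, 0 ≤ k n) (h0 : k 0 ≤ 1 / 2)
    (h : ∀ n, k (n + 1) ≤ 2⁻¹ * ∑ i ∈ Finset.range (n + 1), k i * k (n - i)) (N : ℕ) :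
    ∑ n ∈ Finset.range N, k n ≤ 1 := by
  induction N with
  | zero => simp
  | succ N ih =>
    have hS : 0 ≤ ∑ n ∈ Finset.range N, k n := Finset.sum_nonneg fun n _ => hk n
    have h1 : ∑ n ∈ Finset.range N, ∑ i ∈ Finset.range (n + 1), k i * k (n - i)
        ≤ (∑ n ∈ Finset.range N, k n) * ∑ n ∈ Finset.range N, k n := by
      rw [Finset.sum_range_diag_flip N fun i j => k i * k j, Finset.sum_mul_sum]
      refine Finset.sum_le_sum fun m _ => Finset.sum_le_sum_of_subset_of_nonneg ?_ ?_
      · exact Finset.range_subset_range.2 (Nat.sub_le _ _)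
      · exact fun i _ _ => mul_nonneg (hk m) (hk i)
    have h2 : ∑ n ∈ Finset.range N, k (n + 1)
        ≤ 2⁻¹ * ∑ n ∈ Finset.range N, ∑ i ∈ Finset.range (n + 1), k i * k (n - i) := by
      rw [Finset.mul_sum]
      exact Finset.sum_le_sum fun n _ => h n
    rw [Finset.sum_range_succ']
    nlinarith

/-- The Laplace transform of a probability measure on `(0,∞)` vanishes at infinity. -/
lemma tendsto_integral_exp_neg_mul {ρ : Measure ℝ} [IsProbabilityMeasure ρ]
    (hpos : ∀ᵐ s ∂ρ, 0 < s) :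
    Filter.Tendsto (fun n : ℕ => ∫ s, Real.exp (-(n * s)) ∂ρ) Filter.atTop (nhds 0) := by
  have h := tendsto_integral_of_dominated_convergence (μ := ρ)
    (F := fun (n : ℕ) s => Real.exp (-(n * s))) (f := fun _ => (0 : ℝ)) (fun _ => 1)
    (fun n => by fun_prop) (integrable_const _) ?_ ?_
  · simpa using h
  · intro n
    filter_upwards [hpos] with s hs
    rw [Real.norm_eq_abs, Real.abs_exp, Real.exp_le_one_iff, neg_nonpos]
    positivity
  · filter_upwards [hpos] with s hs
    exact Real.tendsto_exp_neg_atTop_nhds_zero.comp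
      (tendsto_natCast_atTop_atTop.atTop_mul_const hs)

/-- Bounded solutions of the convolutional Riccati equation are unique. -/
lemma riccati_unique {T M : ℝ} {ρ : Measure ℝ} [IsProbabilityMeasure ρ]
    (hpos : ∀ᵐ s ∂ρ, 0 < s) {F X Y : ℝ → ℝ} (hX : Measurable X) (hY : Measurable Y)
    (hXM : ∀ t ∈ Set.Icc 0 T, |X t| ≤ M) (hYM : ∀ t ∈ Set.Icc 0 T, |Y t| ≤ M)
    (hXe : ∀ t ∈ Set.Icc 0 T, X t = F t + 2⁻¹ * mconv (fun u => X u ^ 2) ρ t)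
    (hYe : ∀ t ∈ Set.Icc 0 T, Y t = F t + 2⁻¹ * mconv (fun u => Y u ^ 2) ρ t) :
    ∀ t ∈ Set.Icc 0 T, X t = Y t := by
  intro t₀ ht₀
  have hM0 : 0 ≤ M := (abs_nonneg _).trans (hXM t₀ ht₀)
  obtain ⟨l, hl⟩ : ∃ l : ℕ, M * ∫ s, Real.exp (-(l * s)) ∂ρ ≤ 1 / 2 := by
    have h := (tendsto_integral_exp_neg_mul hpos).const_mul M
    rw [mul_zero] at h
    exact (h.eventually_le_const (by norm_num : (0 : ℝ) < 1 / 2)).exists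
  have hexp : Integrable (fun s => Real.exp (-(l * s))) ρ := by
    refine Integrable.of_bound (by fun_prop) 1 ?_
    filter_upwards [hpos] with s hs
    rw [Real.norm_eq_abs, Real.abs_exp, Real.exp_le_one_iff, neg_nonpos]
    positivity
  have key : ∀ n : ℕ, ∀ t ∈ Set.Icc 0 T,
      |X t - Y t| ≤ 2 * M * (1 / 2) ^ n * Real.exp (l * t) := by
    intro n
    induction n with
    | zero =>
      intro t ht
      have h1 : 1 ≤ Real.exp (l * t) := Real.one_le_exp (mul_nonneg (Nat.cast_nonneg _) ht.1)
      have h2 := abs_sub (X t) (Y t)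
      have h3 := hXM t ht
      have h4 := hYM t ht
      rw [pow_zero, mul_one]
      nlinarith
    | succ n ih =>
      intro t ht
      have sq_le {Z : ℝ → ℝ} (hZ : ∀ t ∈ Set.Icc 0 T, |Z t| ≤ M) :
          ∀ t ∈ Set.Icc 0 T, |Z t ^ 2| ≤ M ^ 2 := fun t ht => by
        rw [abs_pow]
        exact pow_le_pow_left₀ (abs_nonneg _) (hZ t ht) 2
      have hXi := integrableOn_comp_sub (ρ := ρ) (hX.pow_const 2) (sq_le hXM) ht
      have hYi := integrableOn_comp_sub (ρ := ρ) (hY.pow_const 2) (sq_le hYM) ht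
      have hdiff : X t - Y t =
          2⁻¹ * ∫ s in Set.Icc 0 t, (X (t - s) ^ 2 - Y (t - s) ^ 2) ∂ρ := by
        rw [integral_sub hXi hYi, hXe t ht, hYe t ht, mconv, mconv]
        ring
      have hbound : |∫ s in Set.Icc 0 t, (X (t - s) ^ 2 - Y (t - s) ^ 2) ∂ρ| ≤
          ∫ s in Set.Icc 0 t,
            4 * M ^ 2 * (1 / 2) ^ n * Real.exp (l * t) * Real.exp (-(l * s)) ∂ρ := by
        rw [← Real.norm_eq_abs]
        refine norm_integral_le_of_norm_le (hexp.restrict.const_mul _) ?_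
        filter_upwards [ae_restrict_mem measurableSet_Icc] with s hs
        have hu := sub_mem_Icc_of_mem_Icc ht hs
        have h1 := ih _ hu
        have h2 : |X (t - s) + Y (t - s)| ≤ 2 * M := by
          linarith [abs_add_le (X (t - s)) (Y (t - s)), hXM _ hu, hYM _ hu]
        rw [Real.norm_eq_abs, sq_sub_sq, abs_mul]
        refine (mul_le_mul h2 h1 (abs_nonneg _) (by positivity)).trans_eq ?_
        rw [mul_assoc _ (Real.exp _) (Real.exp _), ← Real.exp_add]
        ring_nf
      have hint : ∫ s in Set.Icc 0 t, Real.exp (-(l * s)) ∂ρ ≤ ∫ s, Real.exp (-(l * s)) ∂ρ :=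
        setIntegral_le_integral hexp (Filter.Eventually.of_forall fun s => (Real.exp_pos _).le)
      rw [integral_const_mul] at hbound
      have hc : 0 ≤ 2 * M * (1 / 2) ^ n * Real.exp (l * t) := by positivity
      rw [hdiff, abs_mul, abs_of_pos (by norm_num : (0 : ℝ) < 2⁻¹)]
      calc 2⁻¹ * |∫ s in Set.Icc 0 t, (X (t - s) ^ 2 - Y (t - s) ^ 2) ∂ρ|
          ≤ (2 * M * (1 / 2) ^ n * Real.exp (l * t)) *
              (M * ∫ s in Set.Icc 0 t, Real.exp (-(l * s)) ∂ρ) := by linarith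
        _ ≤ (2 * M * (1 / 2) ^ n * Real.exp (l * t)) * (1 / 2) :=
            mul_le_mul_of_nonneg_left ((mul_le_mul_of_nonneg_left hint hM0).trans hl) hc
        _ = _ := by ring
  have hlim : Filter.Tendsto (fun n : ℕ => 2 * M * (1 / 2 : ℝ) ^ n * Real.exp (l * t₀))
      Filter.atTop (nhds 0) := by
    have h := (tendsto_pow_atTop_nhds_zero_of_lt_one (by norm_num : (0 : ℝ) ≤ 1 / 2)
      (by norm_num)).const_mul (2 * M)
    simpa using h.mul_const (Real.exp (l * t₀))
  have h0 := ge_of_tendsto' hlim fun n => key n t₀ ht₀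
  exact sub_eq_zero.1 (abs_nonpos_iff.1 h0)

/-- For `B = 0` the system only involves the terms of index at least `1`. -/
lemma SolvesSystem.succ_eq_of_zero {T : ℝ} {ρ : Measure ℝ} {F : ℝ → ℝ} {K : ℕ → ℝ → ℝ}
    (hK : SolvesSystem T ρ (fun _ => 0) F K) (n : ℕ) {t : ℝ} (ht : t ∈ Set.Icc 0 T) :
    K (n + 2) t =
      mconv (fun u => 2⁻¹ * ∑ i ∈ Finset.range (n + 1), K (i + 1) u * K (n - i + 1) u) ρ t := by
  obtain ⟨-, -, h0, -, hn⟩ := hK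
  rw [hn (n + 2) (by omega) t ht]
  refine mconv_congr ht fun u hu => ?_
  rw [Finset.sum_range_succ', Finset.sum_range_succ]
  simp only [Nat.sub_self, h0 u hu, mul_zero, zero_mul, add_zero]
  congr 1
  refine Finset.sum_congr rfl fun i hi => ?_
  rw [Finset.mem_range] at hi
  rw [show n + 2 - (i + 1) = n - i + 1 by omega]

/-- If `‖F‖_∞ ≤ 1/2` and `(K_n)` solves the triangular system with
`B = 0`, then `Σ_{n≥1} ‖K_n‖_∞ < ∞` and `K[F] := Σ_{n≥1} K_n` is the unique
bounded Borel solution on `[0,T]` of the convolutional Riccati equation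
`K = F + ½(K²)*ρ`. -/
theorem stmt_14 (T : ℝ) (hT : 0 ≤ T)
    (ρ : Measure ℝ) [IsProbabilityMeasure ρ]
    (hρ0 : ρ {0} = 0) (hρpos : ρ (Set.Iio 0) = 0)
    (F : ℝ → ℝ) (hFmeas : Measurable F)
    (hFbdd : ∃ M : ℝ, ∀ t ∈ Set.Icc 0 T, |F t| ≤ M)
    (hF : supNorm F T ≤ 1 / 2)
    (K : ℕ → ℝ → ℝ) (hK : SolvesSystem T ρ (fun _ => 0) F K) :
    Summable (fun n : ℕ => supNorm (K (n + 1)) T) ∧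
    (∀ t ∈ Set.Icc 0 T,
      (∑' n : ℕ, K (n + 1) t) =
        F t + 2⁻¹ * mconv (fun u => (∑' n : ℕ, K (n + 1) u) ^ 2) ρ t) ∧
    (∀ K' : ℝ → ℝ, Measurable K' →
      (∃ M : ℝ, ∀ t ∈ Set.Icc 0 T, |K' t| ≤ M) →
      (∀ t ∈ Set.Icc 0 T, K' t = F t + 2⁻¹ * mconv (fun u => (K' u) ^ 2) ρ t) →
      ∀ t ∈ Set.Icc 0 T, K' t = ∑' n : ℕ, K (n + 1) t) := by
  have hKn := fun n {t} => hK.succ_eq_of_zero n (t := t)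
  obtain ⟨hKm, hKb, hK0, hK1, -⟩ := hK
  have hpos : ∀ᵐ s ∂ρ, 0 < s := by
    have h : ρ (Set.Iic 0) = 0 := by
      rw [← Set.Iio_union_right]
      exact measure_union_null hρpos hρ0
    filter_upwards [measure_eq_zero_iff_ae_notMem.1 h] with s hs
    exact not_le.1 hs
  have hKF : ∀ t ∈ Set.Icc 0 T, K 1 t = F t := fun t ht => by
    rw [hK1 t ht, mconv_congr (g := fun _ => 0) ht fun u hu => by rw [hK0 u hu, zero_mul]]
    simp [mconv]
  set k : ℕ → ℝ := fun n => supNorm (K (n + 1)) T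
  have hk0 : ∀ n, 0 ≤ k n := fun n => supNorm_nonneg _ _
  have hle : ∀ n, ∀ t ∈ Set.Icc 0 T, |K (n + 1) t| ≤ k n := fun n t ht =>
    abs_le_supNorm (hKb (n + 1)) ht
  set c : ℕ → ℝ := fun n => 2⁻¹ * ∑ i ∈ Finset.range (n + 1), k i * k (n - i) with hc
  set G : ℕ → ℝ → ℝ := fun n u =>
    2⁻¹ * ∑ i ∈ Finset.range (n + 1), K (i + 1) u * K (n - i + 1) u with hG
  have hGm : ∀ n, Measurable (G n) := fun n =>
    (Finset.measurable_sum _ fun i _ => (hKm _).mul (hKm _)).const_mul _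
  have hGc : ∀ n, ∀ u ∈ Set.Icc 0 T, |G n u| ≤ c n := fun n u hu => by
    rw [hG, hc, abs_mul, abs_of_pos (by norm_num : (0 : ℝ) < 2⁻¹)]
    refine mul_le_mul_of_nonneg_left ((Finset.abs_sum_le_sum_abs _ _).trans
      (Finset.sum_le_sum fun i _ => ?_)) (by norm_num)
    rw [abs_mul]
    exact mul_le_mul (hle i u hu) (hle (n - i) u hu) (abs_nonneg _) (hk0 i)
  have hk_half : k 0 ≤ 1 / 2 := (supNorm_le hT fun t ht => by
    rw [zero_add, hKF t ht]
    exact abs_le_supNorm hFbdd ht).trans hF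
  have hk_succ : ∀ n, k (n + 1) ≤ c n := fun n => supNorm_le hT fun t ht => by
    rw [hKn n ht]
    exact abs_mconv_le (hGc n) ht
  have hsum : Summable k :=
    summable_of_sum_range_le hk0 (sum_range_le_one_of_le_convolution hk0 hk_half hk_succ)
  have hnorm : ∀ u ∈ Set.Icc 0 T, Summable fun n => ‖K (n + 1) u‖ := fun u hu =>
    Summable.of_nonneg_of_le (fun n => norm_nonneg _) (fun n => hle n u hu) hsum
  have hcsum : Summable c :=
    (summable_sum_mul_range_of_summable_norm' hsum.norm hsum hsum.norm hsum).mul_left _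
  have hsol : ∀ t ∈ Set.Icc 0 T, (∑' n : ℕ, K (n + 1) t) =
      F t + 2⁻¹ * mconv (fun u => (∑' n : ℕ, K (n + 1) u) ^ 2) ρ t := fun t ht => by
    rw [(hnorm t ht).of_norm.tsum_eq_zero_add, zero_add, hKF t ht]
    congr 1
    rw [tsum_congr fun n => hKn n ht, (hasSum_mconv hGm hGc hcsum ht).tsum_eq]
    rw [mconv_congr (g := fun u => 2⁻¹ * (∑' n : ℕ, K (n + 1) u) ^ 2) ht fun u hu => by
      rw [tsum_mul_left, sq,
        tsum_mul_tsum_eq_tsum_sum_range_of_summable_norm (hnorm u hu) (hnorm u hu)]]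
    exact integral_const_mul _ _
  refine ⟨hsum, hsol, fun K' hK'm ⟨M, hM⟩ hK'e => ?_⟩
  refine riccati_unique (M := max M (∑' n, k n)) hpos hK'm (Measurable.tsum fun n => hKm (n + 1))
    (fun t ht => (hM t ht).trans (le_max_left _ _)) (fun t ht => ?_) hK'e hsol
  exact (tsum_of_norm_bounded (f := fun n => K (n + 1) t) hsum.hasSum fun n => hle n t ht).trans (le_max_right _ _)
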